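/- arXiv:2410.14109 — 2 statements merged into one kernel-verified Lean document; each statement's English description precedes it below -/
import Mathlib

section
/- Let N be a positive natural number and let A be an N×N matrix with entries in {0, 1} representing a strictly directed graph: A has zero diagonal and A i j · A j i = 0 for all i, j (no bidirectional edges). Define the magnetic Hermitian adjacency matrix with charge q = 1/8 by H i j = (1/2)(A i j + A j i) · exp(i·(π/4)·(A i j − A j i)). Then for every real vector h ∈ ℝ^N, the real part of H·h equals (1/(2√2))·(A·h + Aᵀ·h) and the imaginary part of H·h equals (1/(2√2))·(A·h − Aᵀ·h). In particular, the in-neighbor aggregation A·h and the out-neighbor aggregation Aᵀ·h are recoverable as linear combinations of Re(H·h) and Im(H·h). -/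
open Matrix Complex Real

theorem magnetic_laplacian_q_eighth_recovers_directions
    (N : ℕ) (hN : 0 < N)
    (A : Matrix (Fin N) (Fin N) ℝ)
    (hA01 : ∀ i j, A i j = 0 ∨ A i j = 1)
    (hdiag : ∀ i, A i i = 0)
    (hnobi : ∀ i j, A i j * A j i = 0)
    (H : Matrix (Fin N) (Fin N) ℂ)
    (hH : ∀ i j, H i j = (1/2 : ℂ) * ((A i j : ℂ) + (A j i : ℂ)) *
      Complex.exp (Complex.I * (Real.pi / 4 : ℂ) * ((A i j : ℂ) - (A j i : ℂ))))
    (h : Fin N → ℝ) :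
    (fun i => ((H.mulVec (fun k => ((h k : ℂ)))) i).re) =
        (1 / (2 * Real.sqrt 2)) • (A.mulVec h + Aᵀ.mulVec h) ∧
      (fun i => ((H.mulVec (fun k => ((h k : ℂ)))) i).im) =
        (1 / (2 * Real.sqrt 2)) • (A.mulVec h - Aᵀ.mulVec h) := by
  have hs : (1 / (2 * Real.sqrt 2)) = Real.sqrt 2 / 4 := by
    have h2 : Real.sqrt 2 * Real.sqrt 2 = 2 := Real.mul_self_sqrt (by norm_num)
    have h0 : Real.sqrt 2 ≠ 0 := by positivity
    rw [div_eq_div_iff (by positivity) (by norm_num)]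
    linarith
  have key : ∀ i j, (H i j).re = (Real.sqrt 2 / 4) * (A i j + A j i) ∧
      (H i j).im = (Real.sqrt 2 / 4) * (A i j - A j i) := by
    intro i j
    have e : H i j = (((1 / 2) * (A i j + A j i) : ℝ) : ℂ) *
        Complex.exp (((Real.pi / 4 * (A i j - A j i) : ℝ) : ℂ) * Complex.I) := by
      rw [hH]
      push_cast
      congr 2
      ring
    rw [e, Complex.re_ofReal_mul, Complex.im_ofReal_mul, Complex.exp_ofReal_mul_I_re,
      Complex.exp_ofReal_mul_I_im]
    have hn := hnobi i j
    rcases hA01 i j with h1 | h1 <;> rcases hA01 j i with h2 | h2 <;> rw [h1, h2] at hn ⊢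
    · norm_num
    · have : Real.pi / 4 * (0 - 1) = -(Real.pi / 4) := by ring
      rw [this, Real.cos_neg, Real.sin_neg, Real.cos_pi_div_four, Real.sin_pi_div_four]
      constructor <;> ring
    · have : Real.pi / 4 * (1 - 0) = Real.pi / 4 := by ring
      rw [this, Real.cos_pi_div_four, Real.sin_pi_div_four]
      constructor <;> ring
    · norm_num at hn
  rw [hs]
  constructor
  · funext i
    simp only [Matrix.mulVec, dotProduct, Complex.re_sum, Pi.smul_apply, Pi.add_apply,
      smul_eq_mul, Matrix.transpose_apply, Complex.re_mul_ofReal, (key _ _).1]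
    rw [← Finset.sum_add_distrib, Finset.mul_sum]
    exact Finset.sum_congr rfl fun j _ => by ring
  · funext i
    simp only [Matrix.mulVec, dotProduct, Complex.im_sum, Pi.smul_apply, Pi.sub_apply,
      smul_eq_mul, Matrix.transpose_apply, Complex.im_mul_ofReal, (key _ _).2]
    rw [← Finset.sum_sub_distrib, Finset.mul_sum]
    exact Finset.sum_congr rfl fun j _ => by ring
end

section
/- Let φ = arctan(3/4). Then 0 < φ < π/4, and 5·exp(i·φ) + 5·exp(−i·φ) = 8 = 8·exp(i·0). Consequently, the map sending a finite multiset S of real angles contained in the interval [−π/4, π/4] to the complex number Σ_{θ ∈ S} exp(i·θ) is not injective: the multiset consisting of five copies of φ and five copies of −φ is distinct from the multiset consisting of eight copies of 0, yet both have the same image. -/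
open Complex Real Multiset

theorem magnetic_aggregation_not_injective :
    let φ : ℝ := Real.arctan (3/4)
    let f : Multiset ℝ → ℂ := fun S => (S.map (fun θ : ℝ => Complex.exp (Complex.I * (θ : ℂ)))).sum
    let S₁ : Multiset ℝ := Multiset.replicate 5 φ + Multiset.replicate 5 (-φ)
    let S₂ : Multiset ℝ := Multiset.replicate 8 (0 : ℝ)
    0 < φ ∧ φ < Real.pi / 4 ∧
      (5 : ℂ) * Complex.exp (Complex.I * (φ : ℂ)) +
        (5 : ℂ) * Complex.exp (-(Complex.I * (φ : ℂ))) = 8 ∧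
      (8 : ℂ) = 8 * Complex.exp (Complex.I * (0 : ℂ)) ∧
      (∀ θ ∈ S₁, θ ∈ Set.Icc (-(Real.pi / 4)) (Real.pi / 4)) ∧
      (∀ θ ∈ S₂, θ ∈ Set.Icc (-(Real.pi / 4)) (Real.pi / 4)) ∧
      S₁ ≠ S₂ ∧ f S₁ = f S₂ ∧
      ¬ Set.InjOn f {S : Multiset ℝ | ∀ θ ∈ S, θ ∈ Set.Icc (-(Real.pi / 4)) (Real.pi / 4)} := by
  intro φ f S₁ S₂
  have h0 : 0 < φ := Real.arctan_pos.2 (by norm_num)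
  have h1 : φ < Real.pi / 4 := by
    rw [← Real.arctan_one]
    exact Real.arctan_strictMono (by norm_num)
  have hcos : Real.cos φ = 4 / 5 := by
    have h : √(1 + (3 / 4 : ℝ) ^ 2) = 5 / 4 := by
      rw [Real.sqrt_eq_iff_mul_self_eq (by norm_num) (by norm_num)]
      norm_num
    change Real.cos (Real.arctan (3 / 4)) = 4 / 5
    rw [Real.cos_arctan, h]
    norm_num
  have hsum : (5 : ℂ) * Complex.exp (Complex.I * (φ : ℂ)) +
        (5 : ℂ) * Complex.exp (-(Complex.I * (φ : ℂ))) = 8 := by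
    have h2 := Complex.two_cos (φ : ℂ)
    rw [← Complex.ofReal_cos, hcos] at h2
    rw [mul_comm Complex.I, ← neg_mul]
    push_cast at h2
    linear_combination (-5) * h2
  have hS1 : ∀ θ ∈ S₁, θ ∈ Set.Icc (-(Real.pi / 4)) (Real.pi / 4) := by
    intro θ hθ
    rcases Multiset.mem_add.1 hθ with h | h
    · rw [Multiset.eq_of_mem_replicate h]
      constructor <;> linarith
    · rw [Multiset.eq_of_mem_replicate h]
      constructor <;> linarith
  have hS2 : ∀ θ ∈ S₂, θ ∈ Set.Icc (-(Real.pi / 4)) (Real.pi / 4) := by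
    intro θ hθ
    rw [Multiset.eq_of_mem_replicate hθ]
    constructor <;> linarith
  have hne : S₁ ≠ S₂ := by
    intro h
    have := congrArg Multiset.card h
    simp [S₁, S₂] at this
  have hf : f S₁ = f S₂ := by
    simp only [f, S₁, S₂, Multiset.map_add, Multiset.map_replicate, Multiset.sum_add,
      Multiset.sum_replicate, Complex.ofReal_neg, Complex.ofReal_zero, mul_zero, Complex.exp_zero,
      nsmul_eq_mul, mul_neg]
    push_cast
    rw [hsum]
    norm_num
  exact ⟨h0, h1, hsum, by simp, hS1, hS2, hne, hf, fun h => hne (h hS1 hS2 hf)⟩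
end
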